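/- Let U ⊆ ℝ^m be open, let g : U → Matrix (Fin m) (Fin m) ℝ be smooth with g(x) symmetric and invertible for every x, let g^{ab} denote the entries of g(x)⁻¹, s := √|det g|, and let Γ^c_{ab} := ½ g^{cd}(∂_a g_{bd} + ∂_b g_{ad} − ∂_d g_{ab}) be the Levi-Civita Christoffel symbols. Let A : U → ℝ^m be smooth, and define the field strength F_{ab} := ∂_a A_b − ∂_b A_a, raised components F^{ab} := g^{ac} g^{bd} F_{cd}, source current J^b := (1/s) ∂_a (s F^{ab}), and energy-tensor Ŭ^a_b := F^{ac} F_{bc} − ¼ F^{cd} F_{cd} δ^a_b. Then the covariant divergence ∂_a Ŭ^a_b + Γ^a_{ac} Ŭ^c_b − Γ^c_{ab} Ŭ^a_c equals F_{bc} J^c on U. -/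

import Mathlib

open Matrix

noncomputable section

/-- Partial derivative `∂_a f (x)` in the `a`-th coordinate direction of `ℝ^m`. -/
def pd {m : ℕ} (f : (Fin m → ℝ) → ℝ) (a : Fin m) (x : Fin m → ℝ) : ℝ :=
  fderiv ℝ f x (Pi.single a 1)

open scoped Topology

section PartialDerivative

variable {m : ℕ} {f h : (Fin m → ℝ) → ℝ} {x : Fin m → ℝ}

lemma pd_congr (hfh : f =ᶠ[𝓝 x] h) (a : Fin m) : pd f a x = pd h a x := by
  simp only [pd, hfh.fderiv_eq]

lemma pd_sub (hf : DifferentiableAt ℝ f x) (hh : DifferentiableAt ℝ h x) (a : Fin m) :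
    pd (fun t => f t - h t) a x = pd f a x - pd h a x := by
  simp only [pd, fderiv_fun_sub hf hh, _root_.sub_apply]

lemma pd_mul (hf : DifferentiableAt ℝ f x) (hh : DifferentiableAt ℝ h x) (a : Fin m) :
    pd (fun t => f t * h t) a x = pd f a x * h x + f x * pd h a x := by
  simp only [pd, fderiv_fun_mul hf hh, _root_.add_apply,
    _root_.smul_apply, smul_eq_mul]
  ring

lemma pd_const (c : ℝ) (a : Fin m) : pd (fun _ => c) a x = 0 := by
  simp [pd]

lemma pd_pow (hf : DifferentiableAt ℝ f x) (n : ℕ) (a : Fin m) :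
    pd (fun t => f t ^ n) a x = n * f x ^ (n - 1) * pd f a x := by
  simp [pd, fderiv_fun_pow n hf]

lemma pd_sum {ι : Type*} (s : Finset ι) {f : ι → (Fin m → ℝ) → ℝ}
    (hf : ∀ i ∈ s, DifferentiableAt ℝ (f i) x) (a : Fin m) :
    pd (fun t => ∑ i ∈ s, f i t) a x = ∑ i ∈ s, pd (f i) a x := by
  simp only [pd, fderiv_fun_sum hf, _root_.sum_apply]

/-- Smooth functions have smooth partial derivatives. -/
lemma ContDiffAt.pd (hf : ContDiffAt ℝ (⊤ : ℕ∞) f x) (a : Fin m) :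
    ContDiffAt ℝ (⊤ : ℕ∞) (pd f a) x :=
  (hf.fderiv_right (m := (⊤ : ℕ∞)) (by simp)).clm_apply contDiffAt_const

lemma pd_comm (hf : ContDiffAt ℝ (⊤ : ℕ∞) f x) (a b : Fin m) :
    pd (pd f a) b x = pd (pd f b) a x := by
  have hd : DifferentiableAt ℝ (fderiv ℝ f) x :=
    (hf.fderiv_right (m := (⊤ : ℕ∞)) (by simp)).differentiableAt (by simp)
  have key (u v : Fin m) : pd (pd f u) v x =
      fderiv ℝ (fderiv ℝ f) x (Pi.single v 1) (Pi.single u 1) := by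
    change fderiv ℝ (fun t => fderiv ℝ f t (Pi.single u 1)) x (Pi.single v 1) = _
    rw [fderiv_clm_apply hd (differentiableAt_const _)]
    simp
  rw [key, key]
  exact hf.isSymmSndFDerivAt (by
    rw [minSmoothness_of_isRCLikeNormedField]
    exact WithTop.coe_le_coe.2 (le_top : (2 : ℕ∞) ≤ ⊤)) _ _

end PartialDerivative

section MatrixValued

variable {m : ℕ} {ι : Type*} {x : Fin m → ℝ}

/-- The entrywise partial derivative of a matrix-valued function. -/
def pdMatrix (M : (Fin m → ℝ) → Matrix ι ι ℝ) (a : Fin m) (x : Fin m → ℝ) : Matrix ι ι ℝ :=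
  of fun i j => pd (fun t => M t i j) a x

@[simp]
lemma pdMatrix_apply (M : (Fin m → ℝ) → Matrix ι ι ℝ) (a : Fin m) (x : Fin m → ℝ) (i j : ι) :
    pdMatrix M a x i j = pd (fun t => M t i j) a x := rfl

lemma pdMatrix_congr {M N : (Fin m → ℝ) → Matrix ι ι ℝ} (h : M =ᶠ[𝓝 x] N) (a : Fin m) :
    pdMatrix M a x = pdMatrix N a x := by
  ext i j
  exact pd_congr (h.mono fun t ht => by simp only [ht]) a

variable [Fintype ι] {M N : (Fin m → ℝ) → Matrix ι ι ℝ}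

lemma differentiableAt_matrix_mul
    (hM : ∀ i j, DifferentiableAt ℝ (fun t => M t i j) x)
    (hN : ∀ i j, DifferentiableAt ℝ (fun t => N t i j) x) (i j : ι) :
    DifferentiableAt ℝ (fun t => (M t * N t) i j) x := by
  simp only [mul_apply]
  exact .fun_sum fun k _ => (hM i k).mul (hN k j)

lemma pdMatrix_mul
    (hM : ∀ i j, DifferentiableAt ℝ (fun t => M t i j) x)
    (hN : ∀ i j, DifferentiableAt ℝ (fun t => N t i j) x) (a : Fin m) :
    pdMatrix (fun t => M t * N t) a x = pdMatrix M a x * N x + M x * pdMatrix N a x := by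
  ext i j
  simp only [pdMatrix_apply, mul_apply, Matrix.add_apply]
  rw [pd_sum _ fun k _ => (hM i k).fun_mul (hN k j), ← Finset.sum_add_distrib]
  exact Finset.sum_congr rfl fun k _ => pd_mul (hM i k) (hN k j) a

variable [DecidableEq ι]

/-- The determinant as a continuous multilinear map of the rows. -/
def detCMM (ι : Type*) [Fintype ι] [DecidableEq ι] :
    ContinuousMultilinearMap ℝ (fun _ : ι => ι → ℝ) ℝ where
  toMultilinearMap := (detRowAlternating (R := ℝ) (n := ι)).toMultilinearMap
  cont := Continuous.matrix_det (A := fun M : ι → ι → ℝ => (of M : Matrix ι ι ℝ)) continuous_id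

lemma hasFDerivAt_det (hM : ∀ i j, DifferentiableAt ℝ (fun t => M t i j) x) :
    HasFDerivAt (fun t => (M t).det)
      (((detCMM ι).linearDeriv fun i j => M x i j).comp
        (fderiv ℝ (fun t i j => M t i j) x)) x := by
  have h : DifferentiableAt ℝ (fun t i j => M t i j) x :=
    differentiableAt_pi.2 fun i => differentiableAt_pi.2 fun j => hM i j
  exact ((detCMM ι).hasFDerivAt fun i j => M x i j).comp x h.hasFDerivAt

/-- **Jacobi's formula** for the partial derivatives of a determinant. -/
lemma pd_det (hM : ∀ i j, DifferentiableAt ℝ (fun t => M t i j) x) (a : Fin m) :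
    pd (fun t => (M t).det) a x = (adjugate (M x) * pdMatrix M a x).trace := by
  have hrow (i : ι) : DifferentiableAt ℝ (fun t j => M t i j) x :=
    differentiableAt_pi.2 fun j => hM i j
  rw [pd, (hasFDerivAt_det hM).fderiv, trace_mul_comm]
  rw [ContinuousLinearMap.comp_apply, ContinuousMultilinearMap.linearDeriv_apply]
  simp only [trace, diag_apply, mul_apply, pdMatrix_apply]
  refine Finset.sum_congr rfl fun i _ => ?_
  have hi : fderiv ℝ (fun t i j => M t i j) x (Pi.single a 1) i =
      fun j => pd (fun t => M t i j) a x := by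
    ext j
    rw [fderiv_pi hrow, ContinuousLinearMap.pi_apply, fderiv_pi (hM i)]
    rfl
  rw [hi]
  change ((M x).updateRow i _).det = _
  rw [← cramer_transpose_apply, cramer_eq_adjugate_mulVec, ← adjugate_transpose]
  simp [mulVec, dotProduct, mul_comm]

lemma differentiableAt_matrix_inv (hM : ∀ i j, DifferentiableAt ℝ (fun t => M t i j) x)
    (hdet : IsUnit (M x).det) (i j : ι) :
    DifferentiableAt ℝ (fun t => (M t)⁻¹ i j) x := by
  simp only [inv_def, Matrix.smul_apply, Ring.inverse_eq_inv', smul_eq_mul, adjugate_apply]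
  refine ((hasFDerivAt_det hM).differentiableAt.inv hdet.ne_zero).mul
    (hasFDerivAt_det fun k l => ?_).differentiableAt
  rcases eq_or_ne k j with rfl | hk
  · simp
  · simpa [updateRow_ne hk] using hM k l

lemma eventually_isUnit_det (hM : ∀ i j, DifferentiableAt ℝ (fun t => M t i j) x)
    (hdet : IsUnit (M x).det) : ∀ᶠ t in 𝓝 x, IsUnit (M t).det :=
  ((hasFDerivAt_det hM).continuousAt.eventually_ne hdet.ne_zero).mono fun _ h => h.isUnit

lemma pdMatrix_inv (hM : ∀ i j, DifferentiableAt ℝ (fun t => M t i j) x)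
    (hdet : IsUnit (M x).det) (a : Fin m) :
    pdMatrix (fun t => (M t)⁻¹) a x = -((M x)⁻¹ * pdMatrix M a x * (M x)⁻¹) := by
  have hone : pdMatrix (fun t => (M t)⁻¹ * M t) a x = 0 := by
    rw [pdMatrix_congr (N := fun _ => 1)
      ((eventually_isUnit_det hM hdet).mono fun t ht => nonsing_inv_mul _ ht)]
    ext i j
    exact pd_const _ _
  rw [pdMatrix_mul (differentiableAt_matrix_inv hM hdet) hM] at hone
  calc pdMatrix (fun t => (M t)⁻¹) a x
      = pdMatrix (fun t => (M t)⁻¹) a x * M x * (M x)⁻¹ :=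
        (mul_nonsing_inv_cancel_right _ _ hdet).symm
    _ = _ := by rw [eq_neg_of_add_eq_zero_left hone, neg_mul]

lemma differentiableAt_sqrt_abs_det (hM : ∀ i j, DifferentiableAt ℝ (fun t => M t i j) x)
    (hdet : IsUnit (M x).det) :
    DifferentiableAt ℝ (fun t => Real.sqrt |(M t).det|) x :=
  ((hasFDerivAt_det hM).differentiableAt.abs hdet.ne_zero).sqrt (abs_ne_zero.2 hdet.ne_zero)

lemma pd_sqrt_abs_det (hM : ∀ i j, DifferentiableAt ℝ (fun t => M t i j) x)
    (hdet : IsUnit (M x).det) (a : Fin m) :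
    pd (fun t => Real.sqrt |(M t).det|) a x =
      Real.sqrt |(M x).det| * ((1 / 2) * ((M x)⁻¹ * pdMatrix M a x).trace) := by
  have hpow : (fun t => Real.sqrt |(M t).det| ^ 4) = fun t => (M t).det ^ 2 := by
    ext t
    rw [show 4 = 2 * 2 from rfl, pow_mul, Real.sq_sqrt (abs_nonneg _), sq_abs]
  have hpos : 0 < Real.sqrt |(M x).det| := Real.sqrt_pos.2 (abs_pos.2 hdet.ne_zero)
  have hx : Real.sqrt |(M x).det| ^ 4 = (M x).det ^ 2 := congrFun hpow x
  have htr : (M x).det * ((M x)⁻¹ * pdMatrix M a x).trace =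
      (adjugate (M x) * pdMatrix M a x).trace := by
    rw [inv_def, Ring.inverse_eq_inv', smul_mul, trace_smul, smul_eq_mul,
      mul_inv_cancel_left₀ hdet.ne_zero]
  have h := congrArg (fun f => pd f a x) hpow
  beta_reduce at h
  rw [pd_pow (differentiableAt_sqrt_abs_det hM hdet),
    pd_pow (hasFDerivAt_det hM).differentiableAt, pd_det hM, ← htr] at h
  norm_num at h
  refine mul_left_cancel₀ (pow_ne_zero 3 hpos.ne') ?_
  linear_combination h / 4 - (1 / 2) * ((M x)⁻¹ * pdMatrix M a x).trace * hx

end MatrixValued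

section Algebra

variable {m : ℕ}

lemma sum_mul_eq_trace (X Y : Matrix (Fin m) (Fin m) ℝ) :
    ∑ c, ∑ d, X c d * Y c d = (X * Yᵀ).trace := by
  simp [trace, mul_apply]

/-- Contraction of the Bianchi identity with an antisymmetric bivector. -/
lemma sum_mul_eq_of_bianchi {P : Matrix (Fin m) (Fin m) ℝ} (hP : Pᵀ = -P)
    {D : Fin m → Matrix (Fin m) (Fin m) ℝ} (hD : ∀ a, (D a)ᵀ = -D a)
    (hB : ∀ a b c, D a b c + D b c a + D c a b = 0) (b : Fin m) :
    ∑ a, ∑ c, P a c * D a b c = (1 / 2) * ∑ a, ∑ c, P a c * D b a c := by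
  have hP' (a c) : P c a = -P a c := congrFun (congrFun hP a) c
  have hD' (b a c) : D b c a = -D b a c := congrFun (congrFun (hD b) a) c
  have hswap : ∑ a, ∑ c, P a c * D a b c = ∑ a, ∑ c, P a c * D c a b := by
    rw [Finset.sum_comm]
    refine Finset.sum_congr rfl fun a _ => Finset.sum_congr rfl fun c _ => ?_
    rw [hP' a c, hD' c a b]
    ring
  have htwo : ∑ a, ∑ c, P a c * D a b c + ∑ a, ∑ c, P a c * D c a b =
      ∑ a, ∑ c, P a c * D b a c := by
    simp only [← Finset.sum_add_distrib]
    refine Finset.sum_congr rfl fun a _ => Finset.sum_congr rfl fun c _ => ?_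
    linear_combination P a c * hB a b c - P a c * hD' b a c
  linarith

/-- Variation of the raised field strength under variations of the metric and the field,
contracted with the field strength. -/
lemma sum_variation_raised_mul {G F D E : Matrix (Fin m) (Fin m) ℝ} (hG : Gᵀ = G)
    (hF : Fᵀ = -F) :
    ∑ c, ∑ d, (-(G * D * G) * F * G + G * E * G + G * F * -(G * D * G)) c d * F c d =
      ∑ c, ∑ d, (G * F * G) c d * E c d - 2 * (D * (G * F * G * Fᵀ * G)).trace := by
  have h₁ : (G * D * G * F * G * F).trace = (D * (G * F * G * F * G)).trace := by
    simp only [Matrix.mul_assoc]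
    rw [trace_mul_comm G]
    simp only [Matrix.mul_assoc]
  have h₂ : (G * F * (G * D * G) * F).trace = (D * (G * F * G * F * G)).trace := by
    rw [trace_mul_comm, show F * (G * F * (G * D * G)) = (F * G * F * G) * (D * G) by
      simp only [Matrix.mul_assoc], trace_mul_comm]
    simp only [Matrix.mul_assoc]
  have h₃ : (G * E * G * F).trace = -(G * F * G * Eᵀ).trace := by
    rw [← trace_transpose]
    simp only [transpose_mul, hG, hF, Matrix.neg_mul, trace_neg, neg_inj]
    rw [trace_mul_comm (G * F * G), trace_mul_comm]
    simp only [Matrix.mul_assoc]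
    rw [trace_mul_comm G]
    simp only [Matrix.mul_assoc]
  rw [sum_mul_eq_trace, sum_mul_eq_trace, hF]
  simp only [Matrix.add_mul, Matrix.mul_neg, Matrix.neg_mul, trace_add, trace_neg,
    h₁, h₂, h₃]
  ring

/-- Contraction of the Christoffel symbols with the quadratic part of the energy tensor. -/
lemma sum_christoffel_mul {G F : Matrix (Fin m) (Fin m) ℝ} (hG : Gᵀ = G)
    {D : Fin m → Matrix (Fin m) (Fin m) ℝ} (hD : ∀ a, (D a)ᵀ = D a) (b : Fin m) :
    ∑ a, ∑ c, ((1 / 2) * ∑ d, G c d * (D a b d + D b a d - D d a b)) *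
        ∑ d, (G * F * G) a d * F c d =
      (1 / 2) * (D b * (G * F * G * Fᵀ * G)).trace := by
  set T := G * F * G * Fᵀ * G with hT
  have hTs : Tᵀ = T := by
    simp only [hT, transpose_mul, transpose_transpose, hG, Matrix.mul_assoc]
  have hTa (a e) : ∑ c, G c e * ∑ d, (G * F * G) a d * F c d = T a e := by
    rw [hT, mul_apply]
    refine Finset.sum_congr rfl fun c _ => ?_
    rw [mul_comm, mul_apply]
    rfl
  have hD' (b a c) : D b c a = D b a c := congrFun (congrFun (hD b) a) c
  have hTs' (a c) : T c a = T a c := congrFun (congrFun hTs a) c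
  have hreorder (K W : Fin m → ℝ) : ∑ c, ((1 / 2) * ∑ d, G c d * K d) * W c =
      (1 / 2) * ∑ e, K e * ∑ c, G c e * W c := by
    simp only [Finset.mul_sum, Finset.sum_mul]
    rw [Finset.sum_comm]
    refine Finset.sum_congr rfl fun e _ => Finset.sum_congr rfl fun c _ => ?_
    ring
  have hcancel : ∑ a, ∑ e, D a b e * T a e = ∑ a, ∑ e, D e a b * T a e := by
    rw [Finset.sum_comm]
    refine Finset.sum_congr rfl fun a _ => Finset.sum_congr rfl fun e _ => ?_
    rw [hD' e a b, hTs' a e]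
  calc _ = (1 / 2) * ∑ a, ∑ e, (D a b e + D b a e - D e a b) * T a e := by
        rw [Finset.mul_sum]
        refine Finset.sum_congr rfl fun a _ => ?_
        rw [hreorder]
        simp only [hTa]
    _ = (1 / 2) * ∑ a, ∑ e, D b a e * T a e := by
        simp only [sub_mul, add_mul, Finset.sum_sub_distrib, Finset.sum_add_distrib, hcancel]
        ring
    _ = _ := by rw [sum_mul_eq_trace, hTs]

/-- The trace `Γ^c_{ca}` of the Christoffel symbols. -/
lemma sum_christoffel_trace {G : Matrix (Fin m) (Fin m) ℝ} (hG : Gᵀ = G)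
    {D : Fin m → Matrix (Fin m) (Fin m) ℝ} (hD : ∀ a, (D a)ᵀ = D a) (a : Fin m) :
    ∑ c, (1 / 2) * ∑ d, G c d * (D c a d + D a c d - D d c a) =
      (1 / 2) * (G * D a).trace := by
  have hD' (b a c) : D b c a = D b a c := congrFun (congrFun (hD b) a) c
  have hG' (a c) : G c a = G a c := congrFun (congrFun hG a) c
  have hcancel : ∑ c, ∑ d, G c d * D c a d = ∑ c, ∑ d, G c d * D d c a := by
    rw [Finset.sum_comm]
    refine Finset.sum_congr rfl fun c _ => Finset.sum_congr rfl fun d _ => ?_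
    rw [hG' c d, hD' d c a]
  rw [← Finset.mul_sum]
  simp only [mul_sub, mul_add, Finset.sum_sub_distrib, Finset.sum_add_distrib, hcancel]
  rw [sum_mul_eq_trace, hD]
  ring

end Algebra

/-- Abelian (electromagnetic) case of the on-shell divergence of the energy-tensor of a gauge
field: with `s = √|det g|`, `Γ` the Levi-Civita Christoffel symbols, `F_{ab} = ∂_a A_b − ∂_b A_a`,
`F^{ab} = g^{ac} g^{bd} F_{cd}`, source current `J^b = (1/s) ∂_a (s F^{ab})` (the Maxwell
equation `∇_a F^{ab} = J^b` being built into this definition) and Maxwell energy-tensor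
`Ŭ^a_b = F^{ac} F_{bc} − ¼ F^{cd} F_{cd} δ^a_b`, the covariant divergence of `Ŭ` equals the
Lorentz-force term: `∂_a Ŭ^a_b + Γ^a_{ac} Ŭ^c_b − Γ^c_{ab} Ŭ^a_c = F_{bc} J^c` on `U`. -/
theorem maxwell_energy_tensor_on_shell_divergence
    (m : ℕ) (hm : 1 ≤ m)
    (U : Set (Fin m → ℝ)) (hU : IsOpen U)
    (g : (Fin m → ℝ) → Matrix (Fin m) (Fin m) ℝ)
    (hgsm : ∀ a b, ContDiffOn ℝ (⊤ : ℕ∞) (fun x => g x a b) U)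
    (hgsym : ∀ x ∈ U, (g x).IsSymm)
    (hginv : ∀ x ∈ U, IsUnit (g x).det)
    (A : (Fin m → ℝ) → Fin m → ℝ)
    (hA : ∀ b, ContDiffOn ℝ (⊤ : ℕ∞) (fun x => A x b) U) :
    let gi : (Fin m → ℝ) → Matrix (Fin m) (Fin m) ℝ := fun x => (g x)⁻¹
    let s : (Fin m → ℝ) → ℝ := fun x => Real.sqrt |(g x).det|
    let Γ : (Fin m → ℝ) → Fin m → Fin m → Fin m → ℝ := fun x c a b =>
      (1 / 2) * ∑ d, gi x c d *
        (pd (fun t => g t b d) a x + pd (fun t => g t a d) b x - pd (fun t => g t a b) d x)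
    -- field strength `F_{ab}` and raised components `F^{ab}`
    let F : (Fin m → ℝ) → Fin m → Fin m → ℝ := fun x a b =>
      pd (fun t => A t b) a x - pd (fun t => A t a) b x
    let Fup : (Fin m → ℝ) → Fin m → Fin m → ℝ := fun x a b =>
      ∑ c, ∑ d, gi x a c * gi x b d * F x c d
    -- source current `J^b = (1/s) ∂_a (s F^{ab})`
    let J : (Fin m → ℝ) → Fin m → ℝ := fun x b =>
      (1 / s x) * ∑ a, pd (fun t => s t * Fup t a b) a x
    -- Maxwell energy-tensor `Ŭ^a_b`
    let Ub : (Fin m → ℝ) → Fin m → Fin m → ℝ := fun x a b =>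
      (∑ c, Fup x a c * F x b c)
        - (1 / 4) * (∑ c, ∑ d, Fup x c d * F x c d) * (if a = b then 1 else 0)
    ∀ x ∈ U, ∀ b : Fin m,
      (∑ a, pd (fun t => Ub t a b) a x)
        + (∑ a, ∑ c, Γ x a a c * Ub x c b)
        - (∑ a, ∑ c, Γ x c a b * Ub x a c) =
      ∑ c, F x b c * J x c := by
  intro gi s Γ F Fup J Ub x hx b
  have hU' : ∀ᶠ t in 𝓝 x, t ∈ U := hU.mem_nhds hx
  have hgd (i j) : DifferentiableAt ℝ (fun t => g t i j) x :=
    ((hgsm i j).contDiffAt hU').differentiableAt (by simp)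
  have hAc (i) : ContDiffAt ℝ (⊤ : ℕ∞) (fun t => A t i) x := (hA i).contDiffAt hU'
  have hAd (i j) : DifferentiableAt ℝ (pd (fun t => A t i) j) x :=
    ((hAc i).pd j).differentiableAt (by simp)
  have hdet := hginv x hx
  have hgid : ∀ i j, DifferentiableAt ℝ (fun t => gi t i j) x :=
    differentiableAt_matrix_inv hgd hdet
  have hgis (t) (ht : t ∈ U) : (gi t)ᵀ = gi t := by
    rw [transpose_nonsing_inv, (hgsym t ht).eq]
  let FM : (Fin m → ℝ) → Matrix (Fin m) (Fin m) ℝ := fun t => of (F t)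
  have hFd (i j) : DifferentiableAt ℝ (fun t => FM t i j) x := (hAd j i).sub (hAd i j)
  have hFs (t) : (FM t)ᵀ = -FM t := by
    ext i j
    exact (neg_sub _ _).symm
  let P : (Fin m → ℝ) → Matrix (Fin m) (Fin m) ℝ := fun t => gi t * FM t * gi t
  have hPd : ∀ i j, DifferentiableAt ℝ (fun t => P t i j) x :=
    differentiableAt_matrix_mul (differentiableAt_matrix_mul hgid hFd) hgid
  have hFup (t) (ht : t ∈ U) (i j) : Fup t i j = P t i j := by
    have hP : P t = gi t * FM t * (gi t)ᵀ := by rw [hgis t ht]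
    rw [hP]
    simp only [Fup, mul_apply, transpose_apply, Finset.sum_mul]
    rw [Finset.sum_comm]
    exact Finset.sum_congr rfl fun d _ => Finset.sum_congr rfl fun c _ => mul_right_comm _ _ _
  have hPs : (P x)ᵀ = -P x := by
    simp only [P, transpose_mul, hgis x hx, hFs, Matrix.neg_mul, Matrix.mul_neg, Matrix.mul_assoc]
  let D : Fin m → Matrix (Fin m) (Fin m) ℝ := fun a => pdMatrix g a x
  have hDs (a) : (D a)ᵀ = D a := by
    ext i j
    exact pd_congr (hU'.mono fun t ht => (hgsym t ht).apply i j) a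
  let dF : Fin m → Matrix (Fin m) (Fin m) ℝ := fun a => pdMatrix FM a x
  have hdF (a i j) : dF a i j = pd (pd (fun t => A t j) i) a x - pd (pd (fun t => A t i) j) a x :=
    pd_sub (hAd j i) (hAd i j) a
  have hdFs (a) : (dF a)ᵀ = -dF a := by
    ext i j
    rw [transpose_apply, Matrix.neg_apply, hdF, hdF, neg_sub]
  have hbianchi (a b c) : dF a b c + dF b c a + dF c a b = 0 := by
    simp only [hdF]
    rw [pd_comm (hAc c) b a, pd_comm (hAc b) c a, pd_comm (hAc a) c b]
    ring
  let dP : Fin m → Matrix (Fin m) (Fin m) ℝ := fun a => pdMatrix P a x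
  have hdP (a) : dP a = -(gi x * D a * gi x) * FM x * gi x + gi x * dF a * gi x
      + gi x * FM x * -(gi x * D a * gi x) := by
    simp only [dP, P]
    rw [pdMatrix_mul (differentiableAt_matrix_mul hgid hFd) hgid, pdMatrix_mul hgid hFd,
      pdMatrix_inv hgd hdet, Matrix.add_mul]
  let γ : Fin m → ℝ := fun a => (1 / 2) * (gi x * D a).trace
  have hΓ (c) : ∑ a, Γ x a a c = γ c := sum_christoffel_trace (hgis x hx) hDs c
  have hs : s x ≠ 0 := (Real.sqrt_pos.2 (abs_pos.2 hdet.ne_zero)).ne'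
  have hJ (c) : J x c = ∑ a, (γ a * P x a c + dP a a c) := by
    simp only [J]
    rw [Finset.mul_sum]
    refine Finset.sum_congr rfl fun a _ => ?_
    rw [pd_congr (h := fun t => s t * P t a c) (hU'.mono fun t ht => by simp only [hFup t ht]),
      pd_mul (differentiableAt_sqrt_abs_det hgd hdet) (hPd a c), pd_sqrt_abs_det hgd hdet]
    change 1 / s x * (s x * γ a * P x a c + s x * dP a a c) = _
    field_simp
  have hUb (t) (ht : t ∈ U) (a c) : Ub t a c = (∑ d, P t a d * FM t c d)
      - (1 / 4) * (∑ c, ∑ d, P t c d * FM t c d) * (if a = c then 1 else 0) := by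
    simp only [Ub, hFup t ht]
    rfl
  have hPF (i j k l) : DifferentiableAt ℝ (fun t => P t i j * FM t k l) x :=
    (hPd i j).fun_mul (hFd k l)
  have hpdPF (i j k l a) : pd (fun t => P t i j * FM t k l) a x =
      dP a i j * FM x k l + P x i j * dF a k l := pd_mul (hPd i j) (hFd k l) a
  have hQd : DifferentiableAt ℝ (fun t => ∑ c, ∑ d, P t c d * FM t c d) x :=
    .fun_sum fun c _ => .fun_sum fun d _ => hPF c d c d
  have hpdUb (a) : pd (fun t => Ub t a b) a x =
      ∑ c, (dP a a c * FM x b c + P x a c * dF a b c)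
        - (1 / 4) * (∑ c, ∑ d, (dP a c d * FM x c d + P x c d * dF a c d))
          * (if a = b then 1 else 0) := by
    rw [pd_congr (hU'.mono fun t ht => hUb t ht a b),
      pd_sub (.fun_sum fun d _ => hPF a d b d) ((hQd.const_mul _).mul_const _),
      pd_mul (hQd.const_mul _) (differentiableAt_const _),
      pd_mul (differentiableAt_const _) hQd, pd_const, pd_const,
      pd_sum _ fun d _ => hPF a d b d,
      pd_sum _ fun c _ => .fun_sum fun d _ => hPF c d c d]
    simp only [pd_sum _ fun d _ => hPF _ d _ d, hpdPF]
    ring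
  have hdiv : ∑ a, pd (fun t => Ub t a b) a x =
      ∑ a, ∑ c, dP a a c * FM x b c + ∑ a, ∑ c, P x a c * dF a b c
        - (1 / 4) * (∑ c, ∑ d, dP b c d * FM x c d + ∑ c, ∑ d, P x c d * dF b c d) := by
    simp only [hpdUb, Finset.sum_sub_distrib, mul_ite, mul_one, mul_zero, Finset.sum_ite_eq',
      Finset.mem_univ, if_true, Finset.sum_add_distrib]
  have htrace : ∑ a, ∑ c, Γ x a a c * Ub x c b = ∑ c, γ c * (∑ d, P x c d * FM x b d)
      - (1 / 4) * (∑ c, ∑ d, P x c d * FM x c d) * γ b := by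
    rw [Finset.sum_comm]
    simp only [← Finset.sum_mul, hΓ]
    simp only [hUb x hx, mul_sub, Finset.sum_sub_distrib, mul_ite, mul_one, mul_zero,
      Finset.sum_ite_eq', Finset.mem_univ, if_true]
    ring
  have hlower : ∑ a, ∑ c, Γ x c a b * Ub x a c = ∑ a, ∑ c, Γ x c a b * (∑ d, P x a d * FM x c d)
      - (1 / 4) * (∑ c, ∑ d, P x c d * FM x c d) * γ b := by
    simp only [hUb x hx, mul_sub, Finset.sum_sub_distrib, mul_ite, mul_one, mul_zero,
      Finset.sum_ite_eq, Finset.mem_univ, if_true, ← Finset.sum_mul, hΓ]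
    ring
  have hforce : ∑ c, F x b c * J x c =
      ∑ a, ∑ c, dP a a c * FM x b c + ∑ c, γ c * (∑ d, P x c d * FM x b d) := by
    simp only [hJ, Finset.mul_sum]
    rw [Finset.sum_comm]
    simp only [← Finset.sum_add_distrib]
    refine Finset.sum_congr rfl fun a _ => Finset.sum_congr rfl fun c _ => ?_
    change FM x b c * _ = _
    ring
  have hchristoffel : ∑ a, ∑ c, Γ x c a b * (∑ d, P x a d * FM x c d) =
      (1 / 2) * (D b * (P x * (FM x)ᵀ * gi x)).trace :=
    sum_christoffel_mul (hgis x hx) hDs b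
  have hvar : ∑ c, ∑ d, dP b c d * FM x c d = ∑ c, ∑ d, P x c d * dF b c d
      - 2 * (D b * (P x * (FM x)ᵀ * gi x)).trace := by
    rw [hdP]
    exact sum_variation_raised_mul (hgis x hx) (hFs x)
  rw [hdiv, htrace, hlower, hforce, hchristoffel, hvar, sum_mul_eq_of_bianchi hPs hdFs hbianchi b]
  ring
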